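/- arXiv:1610.00176 — 2 statements merged into one kernel-verified Lean document; each statement's English description precedes it below -/
import Mathlib

section
/- Let 2 ≤ c ≤ n. Then the symbolic square of the monomial star configuration ideal decomposes as I_c^{(2)} = I_{c−1} + I_c^2. -/
open MvPolynomial

/-- The ideal generated by the variables `x_i` for `i ∈ S`. -/
noncomputable def varIdeal (k : Type*) [Field k] (n : ℕ) (S : Finset (Fin (n + 1))) :
    Ideal (MvPolynomial (Fin (n + 1)) k) :=
  Ideal.span ((fun i => (X i : MvPolynomial (Fin (n + 1)) k)) '' ↑S)

/-- The monomial star configuration ideal `I_c = ⋂_{|S| = c} P_S`. -/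
noncomputable def monStar (k : Type*) [Field k] (n c : ℕ) :
    Ideal (MvPolynomial (Fin (n + 1)) k) :=
  ⨅ (S : Finset (Fin (n + 1))) (_ : S.card = c), varIdeal k n S

/-- The `m`-th symbolic power `I_c^{(m)} = ⋂_{|S| = c} (P_S)^m`. -/
noncomputable def monStarSymb (k : Type*) [Field k] (n c m : ℕ) :
    Ideal (MvPolynomial (Fin (n + 1)) k) :=
  ⨅ (S : Finset (Fin (n + 1))) (_ : S.card = c), (varIdeal k n S) ^ m

theorem mem_varIdeal {k : Type*} [Field k] {n : ℕ} {S : Finset (Fin (n + 1))}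
    {f : MvPolynomial (Fin (n + 1)) k} :
    f ∈ varIdeal k n S ↔ ∀ d ∈ f.support, ∃ i ∈ S, d i ≠ 0 := by
  simpa [varIdeal] using mem_ideal_span_X_image (x := f) (s := (S : Set (Fin (n + 1))))

theorem mem_varIdeal_sq {k : Type*} [Field k] {n : ℕ} {S : Finset (Fin (n + 1))}
    {f : MvPolynomial (Fin (n + 1)) k} :
    f ∈ varIdeal k n S ^ 2 ↔ ∀ d ∈ f.support, ∃ i ∈ S, ∃ j ∈ S,
      Finsupp.single i 1 + Finsupp.single j 1 ≤ d := by
  have h : varIdeal k n S ^ 2 = Ideal.span ((fun s => monomial s (1 : k)) ''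
      {s | ∃ i ∈ S, ∃ j ∈ S, Finsupp.single i 1 + Finsupp.single j 1 = s}) := by
    rw [sq, varIdeal, Ideal.span_mul_span']
    congr 1
    ext p
    simp only [Set.mem_mul, Set.mem_image, Set.mem_ofPred_eq, Finset.mem_coe]
    constructor
    · rintro ⟨_, ⟨i, hi, rfl⟩, _, ⟨j, hj, rfl⟩, rfl⟩
      exact ⟨_, ⟨i, hi, j, hj, rfl⟩, by simp [X, monomial_mul]⟩
    · rintro ⟨_, ⟨i, hi, j, hj, rfl⟩, rfl⟩
      exact ⟨_, ⟨i, hi, rfl⟩, _, ⟨j, hj, rfl⟩, by simp [X, monomial_mul]⟩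
  rw [h, mem_ideal_span_monomial_image]
  refine forall₂_congr fun d _ => ?_
  constructor
  · rintro ⟨_, ⟨i, hi, j, hj, rfl⟩, hd⟩
    exact ⟨i, hi, j, hj, hd⟩
  · rintro ⟨i, hi, j, hj, hd⟩
    exact ⟨_, ⟨i, hi, j, hj, rfl⟩, hd⟩

theorem mem_monStar {k : Type*} [Field k] {n c : ℕ} {f : MvPolynomial (Fin (n + 1)) k} :
    f ∈ monStar k n c ↔ ∀ S : Finset (Fin (n + 1)), S.card = c →
      ∀ d ∈ f.support, ∃ i ∈ S, d i ≠ 0 := by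
  simp only [monStar, Submodule.mem_iInf, mem_varIdeal]

theorem mem_monStarSymb {k : Type*} [Field k] {n c m : ℕ} {f : MvPolynomial (Fin (n + 1)) k} :
    f ∈ monStarSymb k n c m ↔
      ∀ S : Finset (Fin (n + 1)), S.card = c → f ∈ varIdeal k n S ^ m := by
  simp only [monStarSymb, Submodule.mem_iInf]

/-- A monomial with fewer than `c` vanishing exponents lies in `I_c`. -/
theorem monomial_mem_monStar {k : Type*} [Field k] {n c : ℕ} {d : Fin (n + 1) →₀ ℕ} (a : k)
    (h : {i | d i = 0}.ncard < c) : monomial d a ∈ monStar k n c := by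
  rw [mem_monStar]
  intro S hS e he
  obtain rfl : e = d := Finset.mem_singleton.1 (support_monomial_subset he)
  by_contra! hz
  have := Set.ncard_le_ncard (s := (S : Set (Fin (n + 1)))) (t := {i | e i = 0})
    (fun i hi => hz i hi)
  rw [Set.ncard_coe_finset] at this
  omega

theorem monStar_sq_le_monStarSymb (k : Type*) [Field k] (n c : ℕ) :
    monStar k n c ^ 2 ≤ monStarSymb k n c 2 :=
  le_iInf₂ fun S hS => Ideal.pow_right_mono (iInf₂_le S hS) 2

theorem monStar_pred_le_monStarSymb (k : Type*) [Field k] {n c : ℕ} (hc : 1 ≤ c) :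
    monStar k n (c - 1) ≤ monStarSymb k n c 2 := by
  intro f hf
  rw [mem_monStar] at hf
  refine mem_monStarSymb.2 fun S hS => mem_varIdeal_sq.2 fun d hd => ?_
  obtain ⟨a, ha⟩ : S.Nonempty := Finset.card_pos.1 (by omega)
  obtain ⟨i, hi, hdi⟩ := hf (S.erase a) (by rw [Finset.card_erase_of_mem ha, hS]) d hd
  have hiS := Finset.mem_of_mem_erase hi
  obtain ⟨j, hj, hdj⟩ := hf (S.erase i) (by rw [Finset.card_erase_of_mem hiS, hS]) d hd
  refine ⟨i, hiS, j, Finset.mem_of_mem_erase hj, fun l => ?_⟩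
  have hji := Finset.ne_of_mem_erase hj
  simp only [Finsupp.add_apply, Finsupp.single_apply]
  grind

/-- If every degree-two condition on `c` variables holds for the exponent `d`, the corresponding
monomial lies in `I_{c-1}` or in `I_c ^ 2`. -/
theorem monomial_mem_monStar_pred_add_sq {k : Type*} [Field k] {n c : ℕ} {d : Fin (n + 1) →₀ ℕ}
    (a : k) (h : ∀ S : Finset (Fin (n + 1)), S.card = c → ∃ i ∈ S, ∃ j ∈ S,
      Finsupp.single i 1 + Finsupp.single j 1 ≤ d) :
    monomial d a ∈ monStar k n (c - 1) + monStar k n c ^ 2 := by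
  classical
  have hZ : {i | d i = 0} = ((Finset.univ.filter fun i => d i = 0 : Finset (Fin (n + 1))) :
      Set (Fin (n + 1))) := by ext; simp
  set Z : Finset (Fin (n + 1)) := Finset.univ.filter fun i => d i = 0 with hZdef
  have hpos {i j : Fin (n + 1)} (hij : Finsupp.single i 1 + Finsupp.single j 1 ≤ d) :
      d i ≠ 0 ∧ d j ≠ 0 := by
    have hi := hij i
    have hj := hij j
    simp only [Finsupp.add_apply, Finsupp.single_apply] at hi hj
    grind
  have hlt : Z.card < c := by
    by_contra! hle
    obtain ⟨T, hTZ, hT⟩ := Finset.exists_subset_card_eq hle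
    obtain ⟨i, hi, j, -, hij⟩ := h T hT
    exact (hpos hij).1 (Finset.mem_filter.1 (hTZ hi)).2
  by_cases hlt' : Z.card < c - 1
  · refine Ideal.mem_sup_left (monomial_mem_monStar a ?_)
    rwa [hZ, Set.ncard_coe_finset]
  refine Ideal.mem_sup_right ?_
  have htwo (j : Fin (n + 1)) (hj : d j ≠ 0) : 2 ≤ d j := by
    have hjZ : j ∉ Z := by simpa [hZdef] using hj
    obtain ⟨p, hp, q, hq, hpq⟩ := h (insert j Z) (by rw [Finset.card_insert_of_notMem hjZ]; omega)
    have hmem {r : Fin (n + 1)} (hr : r ∈ insert j Z) (hdr : d r ≠ 0) : r = j :=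
      (Finset.mem_insert.1 hr).resolve_right fun hrZ => hdr (Finset.mem_filter.1 hrZ).2
    obtain rfl := hmem hp (hpos hpq).1
    obtain rfl := hmem hq (hpos hpq).2
    simpa using hpq q
  let e : Fin (n + 1) →₀ ℕ := Finsupp.equivFunOnFinite.symm fun i => if d i = 0 then 0 else 1
  have he : monomial e (1 : k) ∈ monStar k n c := by
    refine monomial_mem_monStar 1 ?_
    have : {i | e i = 0} = {i | d i = 0} := by ext i; simp [e]
    rwa [this, hZ, Set.ncard_coe_finset]
  have hle : e + e ≤ d := fun i => by
    have := htwo i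
    simp only [e, Finsupp.add_apply, Finsupp.equivFunOnFinite_symm_apply_apply]
    grind
  have hfac : monomial d a = monomial (d - (e + e)) a * (monomial e 1 * monomial e 1) := by
    rw [monomial_mul, monomial_mul, tsub_add_cancel_of_le hle, mul_one, mul_one]
  rw [hfac, sq]
  exact Ideal.mul_mem_left _ _ (Ideal.mul_mem_mul he he)

theorem symbolic_square_decomposition (k : Type*) [Field k] (n c : ℕ)
    (hn : 1 ≤ n) (hc : 2 ≤ c) (hcn : c ≤ n) :
    monStarSymb k n c 2 = monStar k n (c - 1) + monStar k n c ^ 2 := by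
  refine le_antisymm (fun f hf => ?_)
    (sup_le (monStar_pred_le_monStarSymb k (by omega)) (monStar_sq_le_monStarSymb k n c))
  rw [f.as_sum]
  exact Ideal.sum_mem _ fun d hd => monomial_mem_monStar_pred_add_sq _ fun S hS =>
    mem_varIdeal_sq.1 (mem_monStarSymb.1 hf S hS) d hd
end

section
/- For every m ≥ 1 there exists an ideal J of R generated by at most 1 + s(m−1) homogeneous polynomials such that I_{2,ℒ}^{(2m)} = I_{2,ℒ}^{2m} + J; in other words, sdefect(I_{2,ℒ}, 2m) ≤ 1 + s(m−1). -/
open MvPolynomial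

/-- The codimension-two linear star configuration ideal `I_{2,ℒ} = ⋂_{i<j} ⟨L_i, L_j⟩`. -/
noncomputable def linStar {k : Type*} [Field k] {s : ℕ}
    (L : Fin s → MvPolynomial (Fin 3) k) : Ideal (MvPolynomial (Fin 3) k) :=
  ⨅ (i : Fin s) (j : Fin s) (_ : i < j), Ideal.span {L i, L j}

/-- The `m`-th symbolic power `I_{2,ℒ}^{(m)} = ⋂_{i<j} ⟨L_i, L_j⟩^m`. -/
noncomputable def linStarSymb {k : Type*} [Field k] {s : ℕ}
    (L : Fin s → MvPolynomial (Fin 3) k) (m : ℕ) : Ideal (MvPolynomial (Fin 3) k) :=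
  ⨅ (i : Fin s) (j : Fin s) (_ : i < j), (Ideal.span {L i, L j}) ^ m

/-- A surjective ring endomorphism of a Noetherian ring is injective. -/
theorem RingHom.injective_of_surjective_endomorphism {R : Type*} [CommRing R] [IsNoetherianRing R]
    (f : R →+* R) (hf : Function.Surjective f) : Function.Injective f := by
  have hmono : Monotone fun n : ℕ => RingHom.ker (f ^ n) := by
    refine monotone_nat_of_le_succ fun n x hx => ?_
    rw [RingHom.mem_ker] at hx ⊢
    rw [pow_succ', RingHom.mul_def, RingHom.comp_apply, hx, map_zero]
  obtain ⟨n, hn⟩ := monotone_stabilizes_iff_noetherian.2 ‹_› ⟨_, hmono⟩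
  rw [injective_iff_map_eq_zero]
  intro x hx
  obtain ⟨y, rfl⟩ : ∃ y, (f ^ n) y = x := by
    rw [RingHom.coe_pow]
    exact hf.iterate n x
  have hy : y ∈ RingHom.ker (f ^ (n + 1)) := by
    rwa [RingHom.mem_ker, pow_succ', RingHom.mul_def, RingHom.comp_apply]
  have := hn (n + 1) n.le_succ
  simp only [OrderHom.coe_mk] at this
  rwa [← this] at hy

/-- If `f` lies in each `⟨x, y j⟩`, and for distinct indices `y i` is a nonzerodivisor modulo
`⟨x, y j⟩`, then `f` lies in `⟨x, ∏ j, y j⟩`. -/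
theorem Ideal.mem_span_pair_prod {R ι : Type*} [CommRing R] {x : R} {y : ι → R} {S : Finset ι}
    (hcancel : ∀ i ∈ S, ∀ j ∈ S, i ≠ j → ∀ b, y i * b ∈ span {x, y j} → b ∈ span {x, y j})
    {f : R} (hf : ∀ j ∈ S, f ∈ span {x, y j}) : f ∈ span {x, ∏ j ∈ S, y j} := by
  classical
  induction S using Finset.induction_on with
  | empty =>
    rw [Finset.prod_empty, eq_top_of_isUnit_mem _ (subset_span (by simp)) isUnit_one]
    exact Submodule.mem_top
  | insert l S hl ih =>
    have hfS := ih (fun i hi j hj => hcancel i (by simp [hi]) j (by simp [hj]))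
      (fun j hj => hf j (by simp [hj]))
    obtain ⟨a, b, rfl⟩ := mem_span_pair.1 hfS
    have hprod : ∀ c, (∏ j ∈ S, y j) * c ∈ span {x, y l} → c ∈ span {x, y l} := by
      refine Finset.prod_induction y (fun z => ∀ c, z * c ∈ span {x, y l} → c ∈ span {x, y l})
        (fun u v hu hv c hc => hv c (hu _ (by rwa [← mul_assoc]))) (by simp) fun i hi => ?_
      exact hcancel i (by simp [hi]) l (by simp) (by rintro rfl; exact hl hi)
    have hb : b ∈ span {x, y l} := by
      refine hprod b ?_
      have := sub_mem (hf l (by simp)) (mul_mem_left _ a (subset_span (by simp : x ∈ {x, y l})))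
      rwa [add_sub_cancel_left, mul_comm] at this
    obtain ⟨d, c, rfl⟩ := mem_span_pair.1 hb
    rw [Finset.prod_insert hl]
    exact mem_span_pair.2 ⟨a + d * ∏ j ∈ S, y j, c, by ring⟩

namespace MvPolynomial

section Coordinates

variable {k : Type*} [Field k]

theorem mem_span_pair_X_pow {w : ℕ} {f : MvPolynomial (Fin 3) k} :
    f ∈ (Ideal.span {X 0, X 1} : Ideal (MvPolynomial (Fin 3) k)) ^ w ↔
      ∀ d ∈ f.support, w ≤ d 0 + d 1 := by
  classical
  constructor
  · induction w generalizing f with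
    | zero => simp
    | succ w ih =>
      intro hf
      rw [pow_succ] at hf
      induction hf using Submodule.mul_induction_on' with
      | mem_mul_mem a ha b hb =>
        intro d hd
        obtain ⟨d₁, h₁, d₂, h₂, rfl⟩ := Finset.mem_add.1 (support_mul a b hd)
        rw [← Set.image_pair X (0 : Fin 3) 1, mem_ideal_span_X_image] at hb
        have := ih ha d₁ h₁
        have := hb d₂ h₂
        simp only [Set.mem_insert_iff, Set.mem_singleton_iff, exists_eq_or_imp,
          exists_eq_left] at this
        simp only [Finsupp.add_apply]
        lia
      | add a _ b _ iha ihb =>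
        intro d hd
        rcases Finset.mem_union.1 (support_add hd) with h | h
        exacts [iha d h, ihb d h]
  · intro h
    rw [f.as_sum]
    refine Ideal.sum_mem _ fun d hd => Ideal.pow_le_pow_right (h d hd) ?_
    rw [monomial_eq, Finsupp.prod_fintype _ _ (by simp), Fin.prod_univ_three, pow_add]
    refine Ideal.mul_mem_left _ _ (Ideal.mul_mem_right _ _ (Ideal.mul_mem_mul ?_ ?_)) <;>
      exact Ideal.pow_mem_pow (Ideal.subset_span (by simp)) _

theorem mem_span_X_pair_pow {w : ℕ} {f : MvPolynomial (Fin 3) k} :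
    f ∈ (Ideal.span {X 0, X 1 ^ w} : Ideal (MvPolynomial (Fin 3) k)) ↔
      ∀ d ∈ f.support, 1 ≤ d 0 ∨ w ≤ d 1 := by
  have : ({X 0, X 1 ^ w} : Set (MvPolynomial (Fin 3) k)) =
      (fun d => monomial d (1 : k)) '' {Finsupp.single 0 1, Finsupp.single 1 w} := by
    rw [Set.image_pair, X_pow_eq_monomial, X]
  rw [this, mem_ideal_span_monomial_image]
  simp

theorem exists_algEquiv_of_linearIndependent {A : Fin 3 → MvPolynomial (Fin 3) k}
    (hA : ∀ i, (A i).IsHomogeneous 1) (hind : LinearIndependent k A) :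
    ∃ e : MvPolynomial (Fin 3) k ≃ₐ[k] MvPolynomial (Fin 3) k, ∀ i, e (X i) = A i := by
  have hle : Submodule.span k (Set.range A) ≤ homogeneousSubmodule (Fin 3) k 1 :=
    Submodule.span_le.2 (by rintro _ ⟨i, rfl⟩; exact hA i)
  have hfin : Module.Finite k (homogeneousSubmodule (Fin 3) k 1) := by
    rw [homogeneousSubmodule_one_eq_span_X]
    exact Module.Finite.span_of_finite k (Set.finite_range _)
  have hspan : Submodule.span k (Set.range A) = homogeneousSubmodule (Fin 3) k 1 := by
    refine Submodule.eq_of_le_of_finrank_le hle ?_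
    rw [finrank_span_eq_card hind, homogeneousSubmodule_one_eq_span_X]
    exact finrank_range_le_card _
  have hsurj : Function.Surjective (aeval A : MvPolynomial (Fin 3) k →ₐ[k] _) := by
    rw [← AlgHom.range_eq_top, eq_top_iff, ← adjoin_range_X, Algebra.adjoin_le_iff]
    rintro _ ⟨i, rfl⟩
    have hi : X i ∈ Submodule.span k (Set.range A) := hspan ▸ isHomogeneous_X k i
    have : Submodule.span k (Set.range A) ≤
        Subalgebra.toSubmodule (aeval A : MvPolynomial (Fin 3) k →ₐ[k] _).range :=
      Submodule.span_le.2 (by rintro _ ⟨j, rfl⟩; exact ⟨X j, aeval_X _ _⟩)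
    exact this hi
  have hinj := RingHom.injective_of_surjective_endomorphism
    (aeval A : MvPolynomial (Fin 3) k →ₐ[k] MvPolynomial (Fin 3) k).toRingHom hsurj
  exact ⟨AlgEquiv.ofBijective _ ⟨hinj, hsurj⟩, fun i => by simp⟩

end Coordinates

section LinearForms

variable {k : Type*} [Field k] {A B C : MvPolynomial (Fin 3) k}

theorem exists_algEquiv_triple (hA : A.IsHomogeneous 1) (hB : B.IsHomogeneous 1)
    (hC : C.IsHomogeneous 1) (hind : LinearIndependent k ![A, B, C]) :
    ∃ e : MvPolynomial (Fin 3) k ≃ₐ[k] MvPolynomial (Fin 3) k,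
      e (X 0) = A ∧ e (X 1) = B ∧ e (X 2) = C := by
  obtain ⟨e, he⟩ := exists_algEquiv_of_linearIndependent
    (by intro i; fin_cases i <;> simpa) hind
  exact ⟨e, he 0, he 1, he 2⟩

theorem apply_mem_span_pair_pow (e : MvPolynomial (Fin 3) k ≃ₐ[k] MvPolynomial (Fin 3) k)
    {a b f : MvPolynomial (Fin 3) k} {w : ℕ} :
    e f ∈ Ideal.span {e a, e b} ^ w ↔ f ∈ Ideal.span {a, b} ^ w := by
  rw [← Set.image_pair e, ← Ideal.map_span, ← Ideal.map_pow, Ideal.mem_map_of_equiv]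
  simp

theorem apply_mem_span_pair (e : MvPolynomial (Fin 3) k ≃ₐ[k] MvPolynomial (Fin 3) k)
    {a b f : MvPolynomial (Fin 3) k} :
    e f ∈ Ideal.span {e a, e b} ↔ f ∈ Ideal.span {a, b} := by
  simpa using apply_mem_span_pair_pow e (a := a) (b := b) (f := f) (w := 1)

theorem mem_span_pair_pow_of_mul_mem (hA : A.IsHomogeneous 1) (hB : B.IsHomogeneous 1)
    (hC : C.IsHomogeneous 1) (hind : LinearIndependent k ![A, B, C]) {w : ℕ}
    {f : MvPolynomial (Fin 3) k} (hf : C * f ∈ Ideal.span {A, B} ^ w) :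
    f ∈ Ideal.span {A, B} ^ w := by
  obtain ⟨e, rfl, rfl, rfl⟩ := exists_algEquiv_triple hA hB hC hind
  obtain ⟨f, rfl⟩ := e.surjective f
  rw [← map_mul] at hf
  rw [apply_mem_span_pair_pow, mem_span_pair_X_pow] at hf ⊢
  intro d hd
  have := hf (Finsupp.single 2 1 + d) (by simpa using hd)
  simpa only [Finsupp.add_apply, Finsupp.single_eq_of_ne (by decide : (0 : Fin 3) ≠ 2),
    Finsupp.single_eq_of_ne (by decide : (1 : Fin 3) ≠ 2), zero_add] using this

theorem mem_span_pair_pow_sub_one_of_mul_mem (hA : A.IsHomogeneous 1) (hB : B.IsHomogeneous 1)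
    (hC : C.IsHomogeneous 1) (hind : LinearIndependent k ![A, B, C]) {w : ℕ}
    {f : MvPolynomial (Fin 3) k} (hf : A * f ∈ Ideal.span {A, B} ^ w) :
    f ∈ Ideal.span {A, B} ^ (w - 1) := by
  obtain ⟨e, rfl, rfl, rfl⟩ := exists_algEquiv_triple hA hB hC hind
  obtain ⟨f, rfl⟩ := e.surjective f
  rw [← map_mul] at hf
  rw [apply_mem_span_pair_pow, mem_span_pair_X_pow] at hf ⊢
  intro d hd
  have := hf (Finsupp.single 0 1 + d) (by simpa using hd)
  simp only [Finsupp.add_apply, Finsupp.single_eq_same,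
    Finsupp.single_eq_of_ne (one_ne_zero : (1 : Fin 3) ≠ 0)] at this
  lia

theorem mem_span_pair_of_mul_mem (hA : A.IsHomogeneous 1) (hB : B.IsHomogeneous 1)
    (hC : C.IsHomogeneous 1) (hind : LinearIndependent k ![A, B, C]) {w v : ℕ}
    {f : MvPolynomial (Fin 3) k} (hf : C ^ v * f ∈ Ideal.span {A, B ^ w}) :
    f ∈ Ideal.span {A, B ^ w} := by
  obtain ⟨e, rfl, rfl, rfl⟩ := exists_algEquiv_triple hA hB hC hind
  induction v with
  | zero => simpa using hf
  | succ v ih =>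
    refine ih ?_
    rw [pow_succ', mul_assoc] at hf
    obtain ⟨g, hg⟩ := e.surjective (e (X 2) ^ v * f)
    rw [← hg] at hf ⊢
    rw [← map_mul] at hf
    rw [← map_pow, apply_mem_span_pair, mem_span_X_pair_pow] at hf ⊢
    intro d hd
    have := hf (Finsupp.single 2 1 + d) (by simpa using hd)
    simpa only [Finsupp.add_apply, Finsupp.single_eq_of_ne (by decide : (0 : Fin 3) ≠ 2),
      Finsupp.single_eq_of_ne (by decide : (1 : Fin 3) ≠ 2), zero_add] using this

theorem span_pair_pow_le (hA : A.IsHomogeneous 1) (hB : B.IsHomogeneous 1)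
    (hC : C.IsHomogeneous 1) (hind : LinearIndependent k ![A, B, C]) (w : ℕ) :
    Ideal.span {A, B} ^ w ≤ Ideal.span {A, B ^ w} := by
  intro f hf
  obtain ⟨e, rfl, rfl, rfl⟩ := exists_algEquiv_triple hA hB hC hind
  obtain ⟨f, rfl⟩ := e.surjective f
  rw [apply_mem_span_pair_pow, mem_span_pair_X_pow] at hf
  rw [← map_pow, apply_mem_span_pair, mem_span_X_pair_pow]
  intro d hd
  have := hf d hd
  lia

end LinearForms

end MvPolynomial

section StarConfiguration

variable {k : Type*} [Field k] {s : ℕ} {L : Fin s → MvPolynomial (Fin 3) k}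

theorem Fin.exists_ne_ne {s : ℕ} (hs : 3 ≤ s) (i j : Fin s) : ∃ l, i ≠ l ∧ j ≠ l := by
  obtain ⟨l, hl⟩ := Finset.exists_mem_notMem_of_card_lt_card (s := {i, j}) (t := Finset.univ)
    (Finset.card_le_two.trans_lt (by rw [Finset.card_univ, Fintype.card_fin]; exact hs))
  simp only [Finset.mem_univ, Finset.mem_insert, Finset.mem_singleton, not_or, true_and] at hl
  exact ⟨l, Ne.symm hl.1, Ne.symm hl.2⟩

theorem Ideal.prod_pow_mem_span_pair_pow {R ι : Type*} [CommRing R] (S : Finset ι) (L : ι → R)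
    (a : ι → ℕ) {i j : ι} (hi : i ∈ S) (hj : j ∈ S) (hij : i ≠ j) {w : ℕ} (hw : w ≤ a i + a j) :
    ∏ l ∈ S, L l ^ a l ∈ span {L i, L j} ^ w := by
  classical
  rw [← Finset.mul_prod_erase S _ hi, ← Finset.mul_prod_erase (S.erase i) _ (a := j) (by grind),
    ← mul_assoc]
  refine mul_mem_right _ _ (pow_le_pow_right hw ?_)
  rw [pow_add]
  exact mul_mem_mul (pow_mem_pow (subset_span (by simp)) _) (pow_mem_pow (subset_span (by simp)) _)

theorem mem_span_prod_pow_of_forall_mem_span_pair_pow (hs : 3 ≤ s)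
    (hlin : ∀ i, (L i).IsHomogeneous 1)
    (hind : ∀ i j l : Fin s, i ≠ j → i ≠ l → j ≠ l → LinearIndependent k ![L i, L j, L l])
    (n : ℕ) (b : Fin s → ℕ) (f : MvPolynomial (Fin 3) k)
    (hf : ∀ i j, i ≠ j → f ∈ Ideal.span {L i, L j} ^ (n - b i - b j)) :
    f ∈ Ideal.span {g | ∃ a : Fin s → ℕ,
      (∀ i j, i ≠ j → n ≤ a i + a j + b i + b j) ∧ g = ∏ i, L i ^ a i} := by
  induction hN : ∑ i, (n + 1 - b i) using Nat.strong_induction_on generalizing b f with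
  | _ N ih =>
  subst hN
  by_cases hb : ∀ i, n < 2 * b i
  · rw [← mul_one f]
    refine Ideal.mul_mem_left _ _ (Ideal.subset_span ⟨0, fun i j _ => ?_, by simp⟩)
    have := hb i
    have := hb j
    simp only [Pi.zero_apply]
    lia
  · push Not at hb
    obtain ⟨i, hi⟩ := hb
    set w : Fin s → ℕ := fun j => n - b i - b j with hw
    have hexp : ∀ p q, p ≠ q →
        n ≤ Function.update w i 0 p + Function.update w i 0 q + b p + b q := by
      intro p q hpq
      simp only [Function.update_apply, hw]
      split_ifs <;> grind
    have hprod : ∏ j ∈ Finset.univ.erase i, L j ^ w j = ∏ j, L j ^ Function.update w i 0 j := by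
      rw [← Finset.mul_prod_erase _ _ (Finset.mem_univ i), Function.update_self, pow_zero, one_mul]
      exact Finset.prod_congr rfl fun j hj => by
        rw [Function.update_of_ne (Finset.ne_of_mem_erase hj)]
    have hmem : f ∈ Ideal.span {L i, ∏ j ∈ Finset.univ.erase i, L j ^ w j} := by
      refine Ideal.mem_span_pair_prod (fun p hp q hq hpq c hc => ?_) fun j hj => ?_
      · have hp := Finset.ne_of_mem_erase hp
        have hq := Finset.ne_of_mem_erase hq
        exact mem_span_pair_of_mul_mem (hlin i) (hlin q) (hlin p)
          (hind i q p hq.symm hp.symm hpq.symm) hc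
      · have hj := Finset.ne_of_mem_erase hj
        obtain ⟨l, hil, hjl⟩ := Fin.exists_ne_ne hs i j
        exact span_pair_pow_le (hlin i) (hlin j) (hlin l) (hind i j l hj.symm hil hjl) _
          (hf i j hj.symm)
    obtain ⟨h, c, rfl⟩ := Ideal.mem_span_pair.1 hmem
    rw [hprod] at hf ⊢
    refine add_mem ?_ (Ideal.mul_mem_left _ _ (Ideal.subset_span ⟨_, hexp, rfl⟩))
    have hLh : ∀ p q, p ≠ q → L i * h ∈ Ideal.span {L p, L q} ^ (n - b p - b q) := by
      intro p q hpq
      rw [mul_comm]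
      refine (Submodule.add_mem_iff_left _ (Ideal.mul_mem_left _ _ ?_)).1 (hf p q hpq)
      refine Ideal.prod_pow_mem_span_pair_pow _ _ _ (Finset.mem_univ p) (Finset.mem_univ q) hpq ?_
      have := hexp p q hpq
      lia
    have hdrop : ∀ q, i ≠ q → h ∈ Ideal.span {L i, L q} ^ (n - (b i + 1) - b q) := by
      intro q hiq
      obtain ⟨l, hil, hql⟩ := Fin.exists_ne_ne hs i q
      have := mem_span_pair_pow_sub_one_of_mul_mem (hlin i) (hlin q) (hlin l)
        (hind i q l hiq hil hql) (hLh i q hiq)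
      rwa [show n - (b i + 1) - b q = n - b i - b q - 1 by lia]
    have hspan := ih _ ?_ (Function.update b i (b i + 1)) h ?_ rfl
    · clear hf hmem hLh hdrop
      induction hspan using Submodule.span_induction with
      | zero => simp
      | add x y _ _ hx hy => rw [add_mul]; exact add_mem hx hy
      | smul r x _ hx => rw [smul_eq_mul, mul_assoc]; exact Ideal.mul_mem_left _ _ hx
      | mem x hx =>
        obtain ⟨a, ha, rfl⟩ := hx
        refine Ideal.subset_span ⟨Function.update a i (a i + 1), fun p q hpq => ?_, ?_⟩
        · have := ha p q hpq
          simp only [Function.update_apply] at this ⊢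
          split_ifs at this ⊢ <;> grind
        · rw [← Finset.prod_erase_mul _ _ (Finset.mem_univ i),
            ← Finset.prod_erase_mul (a := i) _ _ (Finset.mem_univ i), Function.update_self,
            mul_assoc, pow_succ]
          congr 1
          exact Finset.prod_congr rfl fun j hj => by
            rw [Function.update_of_ne (Finset.ne_of_mem_erase hj)]
    · refine Finset.sum_lt_sum (fun j _ => ?_) ⟨i, Finset.mem_univ i, ?_⟩
      · rw [Function.update_apply]
        split_ifs with hj
        · subst hj; lia
        · exact le_rfl
      · rw [Function.update_self]
        lia
    · intro p q hpq
      by_cases hp : p = i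
      · subst hp
        rw [Function.update_self, Function.update_of_ne hpq.symm]
        exact hdrop q hpq
      · by_cases hq : q = i
        · subst hq
          rw [Function.update_self, Function.update_of_ne hp, Set.pair_comm, Nat.sub_right_comm]
          exact hdrop p hpq.symm
        · rw [Function.update_of_ne hp, Function.update_of_ne hq]
          exact mem_span_pair_pow_of_mul_mem (hlin p) (hlin q) (hlin i)
            (hind p q i hpq hp hq) (hLh p q hpq)

theorem mem_linStarSymb {n : ℕ} {f : MvPolynomial (Fin 3) k} :
    f ∈ linStarSymb L n ↔ ∀ i j, i ≠ j → f ∈ Ideal.span {L i, L j} ^ n := by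
  simp only [linStarSymb, Submodule.mem_iInf]
  refine ⟨fun h i j hij => ?_, fun h i j hij => h i j hij.ne⟩
  rcases hij.lt_or_gt with hlt | hlt
  · exact h i j hlt
  · rw [Set.pair_comm]
    exact h j i hlt

theorem linStarSymb_one : linStarSymb L 1 = linStar L := by
  simp only [linStarSymb, linStar, pow_one]

theorem linStar_pow_le_linStarSymb (n : ℕ) : linStar L ^ n ≤ linStarSymb L n := by
  intro f hf
  rw [mem_linStarSymb]
  intro i j hij
  refine Ideal.pow_right_mono (fun g hg => ?_) n hf
  rw [← linStarSymb_one, mem_linStarSymb] at hg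
  simpa using hg i j hij

theorem prod_pow_mem_linStarSymb {n : ℕ} (a : Fin s → ℕ) (ha : ∀ i j, i ≠ j → n ≤ a i + a j) :
    ∏ i, L i ^ a i ∈ linStarSymb L n :=
  mem_linStarSymb.2 fun i j hij => Ideal.prod_pow_mem_span_pair_pow _ _ _ (Finset.mem_univ i)
    (Finset.mem_univ j) hij (ha i j hij)

theorem prod_pow_update_mem_linStar_pow (n : ℕ) (i : Fin s) :
    ∏ j, L j ^ Function.update (fun _ => n) i 0 j ∈ linStar L ^ n := by
  have : ∏ j, L j ^ Function.update (fun _ => n) i 0 j =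
      (∏ j, L j ^ Function.update (fun _ => 1) i 0 j) ^ n := by
    rw [← Finset.prod_pow]
    refine Finset.prod_congr rfl fun j _ => ?_
    rw [← pow_mul]
    congr 1
    simp only [Function.update_apply]
    split_ifs <;> simp
  rw [this, ← linStarSymb_one]
  refine Ideal.pow_mem_pow (prod_pow_mem_linStarSymb _ fun p q hpq => ?_) n
  simp only [Function.update_apply]
  split_ifs <;> grind

end StarConfiguration

theorem sdefect_even_symbolic_power_bound (k : Type*) [Field k] (s : ℕ) (hs : 3 ≤ s)
    (L : Fin s → MvPolynomial (Fin 3) k)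
    (hlin : ∀ i, (L i).IsHomogeneous 1)
    (hind : ∀ i j l : Fin s, i ≠ j → i ≠ l → j ≠ l →
      LinearIndependent k ![L i, L j, L l]) :
    ∀ m : ℕ, 1 ≤ m →
      ∃ T : Finset (MvPolynomial (Fin 3) k),
        (∀ f ∈ T, ∃ d, MvPolynomial.IsHomogeneous f d) ∧
        T.card ≤ 1 + s * (m - 1) ∧
        linStarSymb L (2 * m) =
          linStar L ^ (2 * m) + Ideal.span (T : Set (MvPolynomial (Fin 3) k)) := by
  intro m hm
  classical
  let P : (Fin s → ℕ) → MvPolynomial (Fin 3) k := fun a => ∏ i, L i ^ a i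
  let A : Fin s × ℕ → Fin s → ℕ := fun x => Function.update (fun _ => 2 * m - x.2) x.1 x.2
  let T : Finset (MvPolynomial (Fin 3) k) := insert (P fun _ => m)
    ((Finset.univ ×ˢ Finset.Ico 1 m).image (P ∘ A))
  have hT : ∀ f ∈ T, ∃ a : Fin s → ℕ, (∀ i j, i ≠ j → 2 * m ≤ a i + a j) ∧ f = P a := by
    intro f hf
    rcases Finset.mem_insert.1 hf with rfl | hf
    · exact ⟨_, fun _ _ _ => by lia, rfl⟩
    · obtain ⟨⟨i, c⟩, hic, rfl⟩ := Finset.mem_image.1 hf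
      have hc := Finset.mem_Ico.1 (Finset.mem_product.1 hic).2
      refine ⟨_, fun p q hpq => ?_, rfl⟩
      simp only [A, Function.update_apply]
      split_ifs <;> grind
  refine ⟨T, fun f hf => ?_, ?_, le_antisymm (fun f hf => ?_) ?_⟩
  · obtain ⟨a, -, rfl⟩ := hT f hf
    exact ⟨_, IsHomogeneous.prod _ _ _ fun i _ => (hlin i).pow (a i)⟩
  · refine (Finset.card_insert_le _ _).trans ?_
    rw [add_comm 1]
    refine Nat.succ_le_succ (Finset.card_image_le.trans ?_)
    rw [Finset.card_product, Finset.card_univ, Fintype.card_fin, Nat.card_Ico]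
  · rw [mem_linStarSymb] at hf
    refine Submodule.span_le.2 ?_ (mem_span_prod_pow_of_forall_mem_span_pair_pow hs hlin hind
      (2 * m) 0 f (by simpa using hf))
    rintro _ ⟨a, ha, rfl⟩
    simp only [Pi.zero_apply, add_zero] at ha
    have hdvd : ∀ b : Fin s → ℕ, b ≤ a → P b ∣ ∏ i, L i ^ a i := fun b hb =>
      Finset.prod_dvd_prod_of_dvd _ _ fun i _ => pow_dvd_pow _ (hb i)
    by_cases hle : ∀ i, m ≤ a i
    · exact Ideal.mem_sup_right (Ideal.mem_of_dvd _ (hdvd _ hle)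
        (Ideal.subset_span (Finset.mem_insert_self _ _)))
    · push Not at hle
      obtain ⟨i, hi⟩ := hle
      have hAa : A (i, a i) ≤ a := by
        intro j
        by_cases hj : j = i
        · subst hj
          simp [A]
        · have := ha i j (Ne.symm hj)
          simp only [A, Function.update_of_ne hj]
          lia
      rcases Nat.eq_zero_or_pos (a i) with h0 | hpos
      · rw [h0] at hAa
        exact Ideal.mem_sup_left (Ideal.mem_of_dvd _ (hdvd _ hAa)
          (prod_pow_update_mem_linStar_pow _ i))
      · refine Ideal.mem_sup_right (Ideal.mem_of_dvd _ (hdvd _ hAa) (Ideal.subset_span ?_))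
        refine Finset.mem_insert_of_mem (Finset.mem_image_of_mem (P ∘ A) ?_)
        simp only [Finset.mem_product, Finset.mem_univ, Finset.mem_Ico, true_and]
        exact ⟨hpos, hi⟩
  · refine sup_le (linStar_pow_le_linStarSymb _) (Ideal.span_le.2 fun f hf => ?_)
    obtain ⟨a, ha, rfl⟩ := hT f hf
    exact prod_pow_mem_linStarSymb a ha
end
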